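/- Let δ ⊆ E be a finite set of edges, let r : δ → ℝ_{≥0} and π : 𝒫(δ) → ℝ_{≥0} satisfy π(∅) = 0, Σ_{M ⊆ δ} π(M) = 1, Σ_{e ∈ δ} r(e) = 1, and Σ_{e ∈ M} r(e) ≥ Σ_{M' ⊆ M} π(M') for every M ⊆ δ. Then there exist nonnegative numbers r_{M,e} for all M ⊆ δ and e ∈ M such that r(e) = Σ_{M ∋ e} r_{M,e} for every e ∈ δ and Σ_{e ∈ M} r_{M,e} = π(M) for every nonempty M ⊆ δ. -/

import Mathlib

/-- The layer-cake identity for a point of an interval. -/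
lemma intervalIntegral_ite_lt {A B x : ℝ} (hA : A ≤ x) (hB : x ≤ B) :
    ∫ t in A..B, (if t < x then (1 : ℝ) else 0) = x - A := by
  have h : (fun t : ℝ => if t < x then (1 : ℝ) else 0) = (Set.Iio x).indicator 1 := by
    ext t; simp [Set.indicator_apply]
  rw [h, intervalIntegral.integral_of_le (hA.trans hB),
    MeasureTheory.integral_Ioc_eq_integral_Ioo,
    MeasureTheory.integral_indicator_one measurableSet_Iio,
    MeasureTheory.measureReal_restrict_apply measurableSet_Iio, Set.inter_comm,
    Set.Ioo_inter_Iio, min_eq_right hB]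
  simp [hA]

lemma intervalIntegrable_ite_lt (A B x : ℝ) :
    IntervalIntegrable (fun t => if t < x then (1 : ℝ) else 0) MeasureTheory.volume A B := by
  refine Antitone.intervalIntegrable fun s t hst => ?_
  split_ifs with h₁ h₂ <;> first | exact absurd (hst.trans_lt h₁) h₂ | norm_num

lemma intervalIntegrable_sum_mul_ite_lt {κ : Type*} [Fintype κ] (w f : κ → ℝ) (A B : ℝ) :
    IntervalIntegrable (fun t => ∑ k, w k * (if t < f k then (1 : ℝ) else 0))
      MeasureTheory.volume A B := by
  simpa only [Finset.sum_fn] using IntervalIntegrable.sum Finset.univ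
    fun k _ => (intervalIntegrable_ite_lt A B (f k)).const_mul (w k)

lemma intervalIntegral_sum_mul_ite_lt {κ : Type*} [Fintype κ] (w f : κ → ℝ) {A B : ℝ}
    (hf : ∀ k, A ≤ f k ∧ f k ≤ B) :
    ∫ t in A..B, ∑ k, w k * (if t < f k then (1 : ℝ) else 0)
      = ∑ k, w k * f k - A * ∑ k, w k := by
  rw [intervalIntegral.integral_finsetSum
    fun k _ => (intervalIntegrable_ite_lt _ _ _).const_mul _, Finset.mul_sum,
    ← Finset.sum_sub_distrib]
  refine Finset.sum_congr rfl fun k _ => ?_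
  rw [intervalIntegral.integral_const_mul, intervalIntegral_ite_lt (hf k).1 (hf k).2]
  ring

/-- First-order stochastic dominance implies dominance of expectations, for finitely supported
weights of equal total mass. -/
lemma sum_mul_le_sum_mul_of_upper_tails {α ι : Type*} [Fintype α] [Fintype ι]
    (p g : α → ℝ) (r c : ι → ℝ) (hsum : ∑ a, p a = ∑ e, r e)
    (htail : ∀ t : ℝ, ∑ a with t < g a, p a ≤ ∑ e with t < c e, r e) :
    ∑ a, p a * g a ≤ ∑ e, r e * c e := by
  set R : ℝ := ∑ a, |g a| + ∑ e, |c e|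
  have hg : ∀ a, |g a| ≤ R := fun a =>
    (Finset.single_le_sum (fun b _ => abs_nonneg (g b)) (Finset.mem_univ a)).trans
      (le_add_of_nonneg_right (Finset.sum_nonneg fun _ _ => abs_nonneg _))
  have hc : ∀ e, |c e| ≤ R := fun e =>
    (Finset.single_le_sum (fun b _ => abs_nonneg (c b)) (Finset.mem_univ e)).trans
      (le_add_of_nonneg_left (Finset.sum_nonneg fun _ _ => abs_nonneg _))
  have hRR : -R ≤ R := by
    have : 0 ≤ R := add_nonneg (Finset.sum_nonneg fun _ _ => abs_nonneg _)
      (Finset.sum_nonneg fun _ _ => abs_nonneg _)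
    linarith
  have hmono := intervalIntegral.integral_mono_on hRR (intervalIntegrable_sum_mul_ite_lt p g _ _)
    (intervalIntegrable_sum_mul_ite_lt r c _ _) fun t _ => by
      simpa only [mul_ite, mul_one, mul_zero, ← Finset.sum_filter] using htail t
  rw [intervalIntegral_sum_mul_ite_lt p g (fun a => abs_le.1 (hg a)),
    intervalIntegral_sum_mul_ite_lt r c (fun e => abs_le.1 (hc e)), hsum] at hmono
  linarith

/-- Feasibility of a bipartite transportation problem: supplies `p a`, each of which may be
shipped to the points of `N a` only, can meet the demands `r` exactly as soon as the supplies
confined to any set of points do not exceed its demand and the totals agree. -/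
theorem exists_transport_plan {α ι : Type*} [Fintype α] [Fintype ι] [DecidableEq ι]
    (N : α → Finset ι) (hN : ∀ a, (N a).Nonempty) (p : α → ℝ) (hp : ∀ a, 0 ≤ p a)
    (r : ι → ℝ) (hsum : ∑ a, p a = ∑ e, r e)
    (hdom : ∀ A : Finset ι, ∑ a with N a ⊆ A, p a ≤ ∑ e ∈ A, r e) :
    ∃ ρ : α → ι → ℝ, (∀ a e, 0 ≤ ρ a e) ∧ (∀ a, ∀ e ∉ N a, ρ a e = 0) ∧
      (∀ a, ∑ e, ρ a e = p a) ∧ ∀ e, ∑ a, ρ a e = r e := by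
  let F : α → Set (ι → ℝ) := fun a => stdSimplex ℝ ι ∩ {w | ∀ e ∉ N a, w e = 0}
  let L : (α → ι → ℝ) →ₗ[ℝ] (ι → ℝ) := ∑ a, p a • LinearMap.proj a
  have hL : ∀ w e, L w e = ∑ a, p a * w a e := fun w e => by simp [L]
  have hLc : Continuous L := by
    have : (L : (α → ι → ℝ) → ι → ℝ) = fun w e => ∑ a, p a * w a e := by
      ext w e; exact hL w e
    rw [this]; fun_prop
  have hFc : ∀ a, IsCompact (F a) := fun a => (isCompact_stdSimplex ℝ ι).inter_right <| by
    simp only [Set.ofPred_forall]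
    exact isClosed_iInter fun e => isClosed_iInter fun _ =>
      isClosed_eq (continuous_apply e) continuous_const
  have hFconv : ∀ a, Convex ℝ (F a) := fun a => (convex_stdSimplex ℝ ι).inter <| by
    intro x hx y hy s t _ _ _ e he
    simp [hx e he, hy e he]
  have hK : IsClosed (L '' Set.univ.pi F) := ((isCompact_univ_pi hFc).image hLc).isClosed
  have hKconv : Convex ℝ (L '' Set.univ.pi F) :=
    (convex_pi fun a _ => hFconv a).linear_image L
  have hmem : r ∈ L '' Set.univ.pi F := by
    by_contra hr
    obtain ⟨f, u, hfr, hfK⟩ := geometric_hahn_banach_point_closed hKconv hK hr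
    set c : ι → ℝ := fun e => f (Pi.single e 1)
    have hf : ∀ v : ι → ℝ, f v = ∑ e, v e * c e := fun v => by
      conv_lhs => rw [pi_eq_sum_univ' v]
      simp [c, map_sum]
    choose m hmN hm using fun a => (N a).exists_min_image c (hN a)
    have hw : L (fun a => Pi.single (m a) 1) ∈ L '' Set.univ.pi F := by
      refine Set.mem_image_of_mem _ fun a _ => ⟨single_mem_stdSimplex ℝ (m a), fun e he => ?_⟩
      exact Pi.single_eq_of_ne (fun h : e = m a => he (h ▸ hmN a)) 1
    have hlt := hfr.trans (hfK _ hw)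
    refine hlt.not_ge ?_
    have hval : f (L fun a => Pi.single (m a) 1) = ∑ a, p a * c (m a) := by
      simp only [L, LinearMap.sum_apply, map_sum, LinearMap.smul_apply, LinearMap.proj_apply,
        map_smul, smul_eq_mul, c]
    rw [hval, hf]
    refine sum_mul_le_sum_mul_of_upper_tails p _ r c hsum fun t => ?_
    convert hdom {e | t < c e} using 3 with a
    exact ⟨fun h e he => by simpa using h.trans_le (hm a e he),
      fun h => by simpa using h (hmN a)⟩
  obtain ⟨w, hw, hwr⟩ := hmem
  refine ⟨fun a e => p a * w a e, fun a e => mul_nonneg (hp a) ((hw a trivial).1.1 e),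
    fun a e he => by simp [(hw a trivial).2 e he],
    fun a => by rw [← Finset.mul_sum, (hw a trivial).1.2, mul_one],
    fun e => by rw [← hL, hwr]⟩

/-- Let `δ` be a finite set of edges, `r : δ → ℝ≥0` and `π : 𝒫(δ) → ℝ≥0` with `π(∅) = 0`,
`Σ_{M ⊆ δ} π(M) = 1`, `Σ_{e ∈ δ} r(e) = 1`, and `Σ_{e ∈ M} r(e) ≥ Σ_{M' ⊆ M} π(M')` for
every `M ⊆ δ`. Then there exist nonnegative `r_{M,e}` (for `M ⊆ δ`, `e ∈ M`) with
`r(e) = Σ_{M ∋ e} r_{M,e}` for every `e ∈ δ` and `Σ_{e ∈ M} r_{M,e} = π(M)` for every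
nonempty `M ⊆ δ`. -/
theorem stmt_17 {E : Type*} [DecidableEq E] (δ : Finset E)
    (r : E → ℝ) (π : Finset E → ℝ)
    (hr : ∀ e ∈ δ, 0 ≤ r e) (hπ : ∀ M ∈ δ.powerset, 0 ≤ π M)
    (hπ0 : π ∅ = 0)
    (hπsum : ∑ M ∈ δ.powerset, π M = 1)
    (hrsum : ∑ e ∈ δ, r e = 1)
    (hdom : ∀ M ∈ δ.powerset, ∑ M' ∈ M.powerset, π M' ≤ ∑ e ∈ M, r e) :
    ∃ ρ : Finset E → E → ℝ,
      (∀ M e, 0 ≤ ρ M e) ∧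
      (∀ e ∈ δ, r e = ∑ M ∈ δ.powerset.filter (fun M => e ∈ M), ρ M e) ∧
      (∀ M ∈ δ.powerset, M ≠ ∅ → ∑ e ∈ M, ρ M e = π M) := by
  have hsub : ∀ M : δ.powerset.erase ∅, (M : Finset E) ⊆ δ := fun M =>
    Finset.mem_powerset.1 (Finset.mem_of_mem_erase M.2)
  obtain ⟨σ, hσ, hσN, hσp, hσr⟩ := exists_transport_plan
    (fun M : δ.powerset.erase ∅ => (M : Finset E).subtype (· ∈ δ))
    (fun M => by
      obtain ⟨e, he⟩ := Finset.nonempty_iff_ne_empty.2 (Finset.ne_of_mem_erase M.2)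
      exact ⟨⟨e, hsub M he⟩, Finset.mem_subtype.2 he⟩)
    (fun M => π M) (fun M => hπ _ (Finset.mem_of_mem_erase M.2)) (fun e : δ => r e)
    (by
      rw [Finset.sum_coe_sort (δ.powerset.erase ∅) π, Finset.sum_coe_sort δ r,
        Finset.sum_erase _ hπ0, hπsum, hrsum])
    (fun A => by
      have hA := hdom (A.map (Function.Embedding.subtype _))
        (Finset.mem_powerset.2 (Finset.map_subtype_subset A))
      rw [Finset.sum_map, ← Finset.sum_erase _ hπ0] at hA
      refine le_trans (le_of_eq ?_) hA
      refine Finset.sum_bij (fun M _ => (M : Finset E)) ?_ (fun _ _ _ _ => Subtype.ext) ?_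
        (fun _ _ => rfl)
      · intro M hM
        refine Finset.mem_erase.2 ⟨Finset.ne_of_mem_erase M.2, Finset.mem_powerset.2 ?_⟩
        intro e he
        exact Finset.mem_map.2 ⟨⟨e, hsub M he⟩,
          (Finset.mem_filter.1 hM).2 (Finset.mem_subtype.2 he), rfl⟩
      · intro M hM
        obtain ⟨hne, hMA⟩ := Finset.mem_erase.1 hM
        rw [Finset.mem_powerset] at hMA
        refine ⟨⟨M, Finset.mem_erase.2 ⟨hne, Finset.mem_powerset.2
          (hMA.trans (Finset.map_subtype_subset A))⟩⟩, Finset.mem_filter.2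
            ⟨Finset.mem_univ _, fun e he => ?_⟩, rfl⟩
        obtain ⟨e', he', h⟩ := Finset.mem_map.1 (hMA (Finset.mem_subtype.1 he))
        rwa [← Subtype.ext h])
  let ρ : Finset E → E → ℝ := fun M e =>
    if h : M ∈ δ.powerset.erase ∅ ∧ e ∈ δ then σ ⟨M, h.1⟩ ⟨e, h.2⟩ else 0
  have hρ : ∀ (M : δ.powerset.erase ∅) (e : δ), ρ M e = σ M e := fun M e =>
    dif_pos ⟨M.2, e.2⟩
  have hρ0 : ∀ M ∈ δ.powerset.erase ∅, ∀ e ∈ δ, e ∉ M → ρ M e = 0 := fun M hM e he heM => by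
    rw [hρ ⟨M, hM⟩ ⟨e, he⟩]
    exact hσN _ _ fun h => heM (Finset.mem_subtype.1 h)
  refine ⟨ρ, fun M e => ?_, fun e he => ?_, fun M hM hne => ?_⟩
  · dsimp only [ρ]
    split_ifs
    exacts [hσ _ _, le_rfl]
  · rw [← hσr ⟨e, he⟩, ← Finset.sum_congr rfl fun M _ => hρ M ⟨e, he⟩,
      Finset.sum_coe_sort (δ.powerset.erase ∅) (fun M => ρ M e)]
    symm
    refine Finset.sum_subset (fun M hM => ?_) fun M hM hM' => hρ0 M hM e he fun heM =>
      hM' (Finset.mem_filter.2 ⟨Finset.mem_of_mem_erase hM, heM⟩)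
    obtain ⟨hM, heM⟩ := Finset.mem_filter.1 hM
    exact Finset.mem_erase.2 ⟨Finset.ne_empty_of_mem heM, hM⟩
  · have hM' := Finset.mem_erase.2 ⟨hne, hM⟩
    rw [← hσp ⟨M, hM'⟩, ← Finset.sum_congr rfl fun e _ => hρ ⟨M, hM'⟩ e,
      Finset.sum_coe_sort δ (ρ M)]
    exact Finset.sum_subset (Finset.mem_powerset.1 hM) (hρ0 M hM')
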